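/- Let S ⊆ ℝ² be nonempty, closed, connected, with empty interior, and suppose there exists r_S > 0 such that the distance function d_S is of class C^∞ on the open set {x : 0 < d_S(x) < r_S}. Then S is either a singleton or a 1-dimensional manifold without boundary of class C^∞. -/

import Mathlib

open Metric Set Real

noncomputable section

abbrev E2 := EuclideanSpace ℝ (Fin 2)

/-- The point of the Euclidean plane with coordinates `(a, b)`. -/
def pt (a b : ℝ) : E2 := (EuclideanSpace.equiv (Fin 2) ℝ).symm ![a, b]

/-- `S` is, near `p`, in suitable orthonormal coordinates (i.e. up to a rigid motion `e`),
the graph of a `C^∞` function over an open interval. -/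
def IsCinfGraphAt (S : Set E2) (p : E2) : Prop :=
  ∃ (e : E2 ≃ᵃⁱ[ℝ] E2) (U : Set E2) (g : ℝ → ℝ) (a b : ℝ),
    IsOpen U ∧ p ∈ U ∧ a < b ∧ ContDiff ℝ (⊤ : ℕ∞) g ∧
    e '' (S ∩ U) = (fun t => pt t (g t)) '' Set.Ioo a b

open Filter Topology
open scoped ContDiff InnerProductSpace

section SmoothTube

variable {E : Type*} [NormedAddCommGroup E] [InnerProductSpace ℝ E] [FiniteDimensional ℝ E]
  {S : Set E} {r : ℝ} {x p q w : E} {s : ℝ}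

/-- The open tube of radius `r` around `S`, with `S` removed. -/
def tube (S : Set E) (r : ℝ) : Set E := {x | 0 < infDist x S ∧ infDist x S < r}

/-- `S` is closed and nonempty and its distance function is smooth on a tube of radius `r`. -/
structure SmoothTube (S : Set E) (r : ℝ) : Prop where
  nonempty : S.Nonempty
  isClosed : IsClosed S
  pos : 0 < r
  contDiffOn : ContDiffOn ℝ ∞ (fun x => infDist x S) (tube S r)

/-- The gradient of the distance function of `S`. -/
def distGrad (S : Set E) (x : E) : E := gradient (fun y => infDist y S) x

/-- The candidate for the nearest point of `S`, in terms of the gradient of the distance. -/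
def foot (S : Set E) (x : E) : E := x - infDist x S • distGrad S x

/-- `w` is a unit vector normal to `S` at `p`, in the sense that `p` is a nearest point of `S` to
every point of the segment of length `r` issuing from `p` in the direction `w`. -/
structure IsUnitNormal (S : Set E) (r : ℝ) (p w : E) : Prop where
  mem : p ∈ S
  norm_eq : ‖w‖ = 1
  infDist_eq : ∀ s ∈ Ioo 0 r, infDist (p + s • w) S = s

omit [InnerProductSpace ℝ E] [FiniteDimensional ℝ E] in
lemma isOpen_tube : IsOpen (tube S r) :=
  (isOpen_lt continuous_const (continuous_infDist_pt S)).inter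
    (isOpen_lt (continuous_infDist_pt S) continuous_const)

lemma norm_distGrad_le : ‖distGrad S x‖ ≤ 1 := by
  have h := norm_fderiv_le_of_lipschitz ℝ (x₀ := x) (lipschitz_infDist_pt S)
  rw [← toDual_gradient, LinearIsometryEquiv.norm_map, NNReal.coe_one] at h
  exact h

/-- Differentiability of the distance at `x` determines the nearest points of `S` to `x`. -/
lemma sub_eq_infDist_smul_distGrad (hd : DifferentiableAt ℝ (fun y => infDist y S) x)
    (hq : q ∈ S) (hxq : infDist x S = dist x q) :
    x - q = infDist x S • distGrad S x := by
  set t := infDist x S with ht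
  have hn : ‖x - q‖ = t := by rw [← dist_eq_norm, hxq]
  have hinner : ⟪distGrad S x, x - q⟫_ℝ = t := by
    have hline : HasDerivAt (fun s : ℝ => x + s • (x - q)) (x - q) 0 := by
      simpa using ((hasDerivAt_id (0 : ℝ)).smul_const (x - q)).const_add x
    have hcomp : HasDerivAt (fun s : ℝ => infDist (x + s • (x - q)) S)
        (⟪distGrad S x, x - q⟫_ℝ) 0 := by
      have h := HasFDerivAt.comp_hasDerivAt (x := (0 : ℝ))
        (l := fun y => infDist y S) (l' := fderiv ℝ (fun y => infDist y S) x)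
        (f := fun s : ℝ => x + s • (x - q)) (f' := x - q) (by simpa using hd.hasFDerivAt) hline
      rw [distGrad, inner_gradient_left]
      exact h
    have hdiff := hcomp.sub ((hasDerivAt_id (0 : ℝ)).const_add 1 |>.mul_const t)
    have hmax : IsLocalMax ((fun s : ℝ => infDist (x + s • (x - q)) S) -
        fun s : ℝ => (1 + id s) * t) 0 := by
      filter_upwards [lt_mem_nhds (show (-1 : ℝ) < 0 by norm_num)] with s hs
      have h1 : infDist (x + s • (x - q)) S ≤ (1 + s) * t := by
        refine (infDist_le_dist_of_mem hq).trans_eq ?_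
        rw [dist_eq_norm, show x + s • (x - q) - q = (1 + s) • (x - q) by module, norm_smul, hn,
          Real.norm_of_nonneg (by linarith)]
      simp only [Pi.sub_apply, id, zero_smul, add_zero, ← ht]
      linarith
    have := hmax.hasDerivAt_eq_zero hdiff
    linarith
  have hle : ‖distGrad S x‖ ≤ 1 := norm_distGrad_le
  have hsq : ‖x - q - t • distGrad S x‖ ^ 2 ≤ 0 := by
    rw [norm_sub_sq_real, inner_smul_right, real_inner_comm, hinner, norm_smul, hn, mul_pow,
      Real.norm_eq_abs, sq_abs]
    have : ‖distGrad S x‖ ^ 2 ≤ 1 := pow_le_one₀ (norm_nonneg _) hle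
    nlinarith [sq_nonneg t]
  have h0 : ‖x - q - t • distGrad S x‖ = 0 := by
    nlinarith [norm_nonneg (x - q - t • distGrad S x)]
  exact sub_eq_zero.mp (norm_eq_zero.mp h0)

namespace SmoothTube

variable (hS : SmoothTube S r)
include hS

omit [FiniteDimensional ℝ E] in
lemma contDiffAt (hx : x ∈ tube S r) : ContDiffAt ℝ ∞ (fun y => infDist y S) x :=
  hS.contDiffOn.contDiffAt (isOpen_tube.mem_nhds hx)

omit [FiniteDimensional ℝ E] in
lemma differentiableAt (hx : x ∈ tube S r) : DifferentiableAt ℝ (fun y => infDist y S) x :=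
  (hS.contDiffAt hx).differentiableAt (by simp)

lemma hasFDerivAt_infDist (hx : x ∈ tube S r) :
    HasFDerivAt (fun y => infDist y S) (innerSL ℝ (distGrad S x)) x :=
  (hS.differentiableAt hx).hasGradientAt.hasFDerivAt

lemma contDiffAt_distGrad (hx : x ∈ tube S r) : ContDiffAt ℝ ∞ (distGrad S) x :=
  ((InnerProductSpace.toDual ℝ E).symm.contDiff.contDiffAt).comp x
    ((hS.contDiffAt hx).fderiv_right (m := ∞) (by simp))

lemma continuousAt_distGrad (hx : x ∈ tube S r) : ContinuousAt (distGrad S) x :=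
  (hS.contDiffAt_distGrad hx).continuousAt

lemma hasFDerivAt_distGrad (hx : x ∈ tube S r) :
    HasFDerivAt (distGrad S) (fderiv ℝ (distGrad S) x) x :=
  ((hS.contDiffAt_distGrad hx).differentiableAt (by simp)).hasFDerivAt

lemma continuousAt_fderiv_distGrad (hx : x ∈ tube S r) :
    ContinuousAt (fderiv ℝ (distGrad S)) x :=
  ((hS.contDiffAt_distGrad hx).fderiv_right (m := ∞) (by simp)).continuousAt

lemma foot_mem (hx : x ∈ tube S r) : foot S x ∈ S := by
  obtain ⟨q, hq, hxq⟩ := hS.isClosed.exists_infDist_eq_dist hS.nonempty x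
  rwa [foot, ← sub_eq_infDist_smul_distGrad (hS.differentiableAt hx) hq hxq, sub_sub_cancel]

lemma norm_distGrad (hx : x ∈ tube S r) : ‖distGrad S x‖ = 1 := by
  obtain ⟨q, hq, hxq⟩ := hS.isClosed.exists_infDist_eq_dist hS.nonempty x
  have h := congrArg norm (sub_eq_infDist_smul_distGrad (hS.differentiableAt hx) hq hxq)
  rw [← dist_eq_norm, ← hxq, norm_smul, Real.norm_of_nonneg hx.1.le] at h
  exact (mul_eq_left₀ hx.1.ne').mp h.symm

omit hS in
lemma foot_add (x : E) : foot S x + infDist x S • distGrad S x = x := sub_add_cancel _ _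

lemma infDist_foot_add_of_le (hx : x ∈ tube S r) (hs : 0 ≤ s) (hsx : s ≤ infDist x S) :
    infDist (foot S x + s • distGrad S x) S = s := by
  have hV := hS.norm_distGrad hx
  apply le_antisymm
  · refine (infDist_le_dist_of_mem (hS.foot_mem hx)).trans_eq ?_
    rw [dist_eq_norm, add_sub_cancel_left, norm_smul, hV, mul_one, Real.norm_of_nonneg hs]
  · have h := infDist_le_infDist_add_dist (s := S) (x := x) (y := foot S x + s • distGrad S x)
    have h2 : dist x (foot S x + s • distGrad S x) = infDist x S - s := by
      rw [dist_eq_norm, show x - (foot S x + s • distGrad S x) =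
        (infDist x S - s) • distGrad S x by rw [foot]; module, norm_smul, hV, mul_one,
        Real.norm_of_nonneg (by linarith)]
    linarith

lemma distGrad_eq (hp : p ∈ S) (hw : ‖w‖ = 1) (hs : s ∈ Ioo 0 r)
    (hd : infDist (p + s • w) S = s) : distGrad S (p + s • w) = w := by
  have hx : p + s • w ∈ tube S r := by simpa [tube, hd] using hs
  have h := sub_eq_infDist_smul_distGrad (hS.differentiableAt hx) hp
    (by rw [hd, dist_eq_norm, add_sub_cancel_left, norm_smul, hw, mul_one,
      Real.norm_of_nonneg hs.1.le])
  rw [hd, add_sub_cancel_left] at h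
  exact (smul_right_injective E hs.1.ne' h).symm

/-- Locally, the distance grows at unit rate in the direction of its gradient. -/
lemma exists_infDist_add (hx : x ∈ tube S r) :
    ∃ ε > 0, ∀ s ∈ Ioo 0 ε, infDist (x + s • distGrad S x) S = infDist x S + s := by
  obtain ⟨K, u, hu, hK⟩ :=
    ((hS.contDiffAt_distGrad hx).of_le (by simp : (1 : WithTop ℕ∞) ≤ ∞)).exists_lipschitzOnWith
  obtain ⟨δ, hδ, hδu⟩ := Metric.nhds_basis_closedBall.mem_iff.mp
    (inter_mem hu (isOpen_tube.mem_nhds hx))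
  refine ⟨min (min δ (infDist x S / 2)) (1 / (K + 1)), by have := hx.1; positivity, fun s hs => ?_⟩
  obtain ⟨hs0, hs1⟩ := hs
  have hsδ : s < δ := hs1.trans_le ((min_le_left _ _).trans (min_le_left _ _))
  have hsd : s < infDist x S / 2 := hs1.trans_le ((min_le_left _ _).trans (min_le_right _ _))
  have hsK : s * K < 1 := by
    have := hs1.trans_le (min_le_right _ _)
    rw [lt_div_iff₀ (by positivity)] at this
    linarith
  set f : E → E := fun y => x + s • distGrad S y with hf
  have hmaps : MapsTo f (closedBall x δ) (closedBall x δ) := by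
    intro y hy
    rw [mem_closedBall, dist_eq_norm, hf, add_sub_cancel_left, norm_smul,
      hS.norm_distGrad (hδu hy).2, mul_one, Real.norm_of_nonneg hs0.le]
    exact hsδ.le
  have hcontr : ContractingWith (s.toNNReal * K) (hmaps.restrict f _ _) := by
    refine ⟨?_, LipschitzWith.of_dist_le_mul fun y z => ?_⟩
    · rw [← NNReal.coe_lt_coe]
      simpa [Real.coe_toNNReal _ hs0.le] using hsK
    · have h := hK.dist_le_mul y (hδu y.2).1 z (hδu z.2).1
      rw [Subtype.dist_eq, MapsTo.val_restrict_apply, MapsTo.val_restrict_apply, hf,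
        dist_add_left, dist_smul₀, Real.norm_of_nonneg hs0.le, NNReal.coe_mul,
        Real.coe_toNNReal _ hs0.le, mul_assoc]
      exact mul_le_mul_of_nonneg_left h hs0.le
  obtain ⟨y, hy, hfix, -⟩ := hcontr.exists_fixedPoint' isClosed_closedBall.isComplete hmaps
    (mem_closedBall_self hδ.le) (edist_ne_top _ _)
  have hyT := (hδu hy).2
  have hyx : x + s • distGrad S y = y := hfix
  have hVy := hS.norm_distGrad hyT
  have hdist : dist x y = s := by
    rw [dist_comm, dist_eq_norm, show y - x = s • distGrad S y from sub_eq_of_eq_add' hyx.symm,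
      norm_smul, hVy, mul_one, Real.norm_of_nonneg hs0.le]
  have hsy : s < infDist y S := by
    have := infDist_le_infDist_add_dist (s := S) (x := x) (y := y)
    linarith
  have hxe : x = foot S y + (infDist y S - s) • distGrad S y := by
    rw [foot]; nth_rw 1 [eq_sub_of_add_eq hyx]; module
  have hxd : infDist x S = infDist y S - s := by
    conv_lhs => rw [hxe]
    exact hS.infDist_foot_add_of_le hyT (by linarith) (by linarith)
  have hV : distGrad S x = distGrad S y := by
    conv_lhs => rw [hxe]
    refine hS.distGrad_eq (hS.foot_mem hyT) hVy ⟨by linarith, by linarith [hyT.2]⟩ ?_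
    rw [← hxe, hxd]
  rw [hV, hyx, hxd]
  ring

lemma isUnitNormal_foot (hx : x ∈ tube S r) : IsUnitNormal S r (foot S x) (distGrad S x) := by
  refine ⟨hS.foot_mem hx, hS.norm_distGrad hx, fun s hs => ?_⟩
  rcases le_total s (infDist x S) with h | h
  · exact hS.infDist_foot_add_of_le hx hs.1.le h
  set T : Set ℝ := {a | infDist (foot S x + a • distGrad S x) S = a} with hT
  have hcl : IsClosed T := isClosed_eq ((continuous_infDist_pt S).comp (by fun_prop)) continuous_id
  have hsub : Icc (infDist x S) s ⊆ T := by
    refine (hcl.inter isClosed_Icc).Icc_subset_of_forall_exists_gt (by simp [hT, foot_add]) ?_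
    rintro a ⟨haT, ha⟩ b hb
    have ha' : a ∈ Ioo 0 r := ⟨hx.1.trans_le ha.1, ha.2.trans hs.2⟩
    have hV := hS.distGrad_eq (hS.foot_mem hx) (hS.norm_distGrad hx) ha' haT
    obtain ⟨ε, hε, h⟩ := hS.exists_infDist_add (x := foot S x + a • distGrad S x)
      (by simpa [tube, show infDist (foot S x + a • distGrad S x) S = a from haT] using ha')
    have hδ : 0 < min (ε / 2) (b - a) := lt_min (by linarith) (sub_pos.mpr hb)
    refine ⟨a + min (ε / 2) (b - a), ?_, by linarith, by linarith [min_le_right (ε / 2) (b - a)]⟩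
    have h2 := h _ ⟨hδ, by linarith [min_le_left (ε / 2) (b - a)]⟩
    rw [hV, show infDist (foot S x + a • distGrad S x) S = a from haT, add_assoc, ← add_smul] at h2
    exact h2
  exact hsub ⟨h, le_rfl⟩

end SmoothTube

namespace IsUnitNormal

variable (h : IsUnitNormal S r p w)
include h

omit [FiniteDimensional ℝ E] in
lemma mem_tube (hs : s ∈ Ioo 0 r) : p + s • w ∈ tube S r := by
  simpa [tube, h.infDist_eq s hs] using hs

lemma distGrad_eq (hS : SmoothTube S r) (hs : s ∈ Ioo 0 r) : distGrad S (p + s • w) = w :=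
  hS.distGrad_eq h.mem h.norm_eq hs (h.infDist_eq s hs)

end IsUnitNormal

omit [FiniteDimensional ℝ E] in
lemma IsUnitNormal.of_tendsto (hcl : IsClosed S) {ι : Type*} {l : Filter ι} [l.NeBot]
    {P W : ι → E} (hP : Tendsto P l (𝓝 p)) (hW : Tendsto W l (𝓝 w))
    (h : ∀ᶠ i in l, IsUnitNormal S r (P i) (W i)) : IsUnitNormal S r p w where
  mem := hcl.mem_of_tendsto hP (h.mono fun _ hi => hi.mem)
  norm_eq := tendsto_nhds_unique hW.norm
    (tendsto_const_nhds.congr' (h.mono fun _ hi => hi.norm_eq.symm))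
  infDist_eq s hs := tendsto_nhds_unique
    (((continuous_infDist_pt S).tendsto _).comp (hP.add (hW.const_smul s)))
    (tendsto_const_nhds.congr' (h.mono fun _ hi => (hi.infDist_eq s hs).symm))

/-- Translation of `x` by `-s` along the gradient of the distance. -/
def normalShift (S : Set E) (s : ℝ) (x : E) : E := x - s • distGrad S x

/-- The derivative of `normalShift S s` at `x`. -/
def shiftDeriv (S : Set E) (s : ℝ) (x : E) : E →L[ℝ] E :=
  ContinuousLinearMap.id ℝ E - s • fderiv ℝ (distGrad S) x

lemma shiftDeriv_apply (u : E) :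
    shiftDeriv S s x u = u - s • fderiv ℝ (distGrad S) x u := rfl

lemma normalShift_eq : normalShift S s x = foot S x + (infDist x S - s) • distGrad S x := by
  rw [normalShift, foot]; module

lemma exists_equiv_of_injective {F : Type*} [NormedAddCommGroup F] [NormedSpace ℝ F]
    [FiniteDimensional ℝ F] (hEF : Module.finrank ℝ E = Module.finrank ℝ F) (A : E →L[ℝ] F)
    (hA : ∀ u, A u = 0 → u = 0) : ∃ e : E ≃L[ℝ] F, (e : E →L[ℝ] F) = A :=
  ⟨(LinearMap.linearEquivOfInjective (A : E →ₗ[ℝ] F)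
    ((injective_iff_map_eq_zero A).mpr hA) hEF).toContinuousLinearEquiv, by ext; rfl⟩

omit [InnerProductSpace ℝ E] [FiniteDimensional ℝ E] in
lemma tendsto_infDist_zero (hp : p ∈ S) {z : ℕ → E} (hzp : Tendsto z atTop (𝓝 p)) :
    Tendsto (fun n => infDist (z n) S) atTop (𝓝 0) := by
  have := ((continuous_infDist_pt S).tendsto p).comp hzp
  rwa [infDist_zero_of_mem hp] at this

namespace SmoothTube

variable (hS : SmoothTube S r)
include hS

lemma hasFDerivAt_normalShift (hx : x ∈ tube S r) :
    HasFDerivAt (normalShift S s) (shiftDeriv S s x) x :=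
  (hasFDerivAt_id x).sub ((hS.hasFDerivAt_distGrad hx).const_smul s)

lemma contDiffAt_normalShift (hx : x ∈ tube S r) : ContDiffAt ℝ ∞ (normalShift S s) x :=
  contDiffAt_id.sub ((hS.contDiffAt_distGrad hx).const_smul s)

lemma hasFDerivAt_foot (hx : x ∈ tube S r) :
    HasFDerivAt (foot S) (shiftDeriv S (infDist x S) x -
      (innerSL ℝ (distGrad S x)).smulRight (distGrad S x)) x := by
  refine ((hasFDerivAt_id x).sub
    ((hS.hasFDerivAt_infDist hx).smul (hS.hasFDerivAt_distGrad hx))).congr_fderiv ?_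
  rw [shiftDeriv, sub_sub]

lemma continuousAt_foot (hx : x ∈ tube S r) : ContinuousAt (foot S) x :=
  (hS.hasFDerivAt_foot hx).continuousAt

lemma inner_distGrad_fderiv (hx : x ∈ tube S r) (u : E) :
    ⟪distGrad S x, fderiv ℝ (distGrad S) x u⟫_ℝ = 0 := by
  have h := (hS.hasFDerivAt_distGrad hx).norm_sq
  have hc : (fun y => ‖distGrad S y‖ ^ 2) =ᶠ[𝓝 x] fun _ => (1 : ℝ) := by
    filter_upwards [isOpen_tube.mem_nhds hx] with y hy
    rw [hS.norm_distGrad hy, one_pow]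
  have h2 := congrArg (fun A => A u) (h.unique
    ((hasFDerivAt_const (1 : ℝ) x).congr_of_eventuallyEq hc))
  simpa using h2

lemma fderiv_distGrad_self (hx : x ∈ tube S r) :
    fderiv ℝ (distGrad S) x (distGrad S x) = 0 := by
  have hN := hS.isUnitNormal_foot hx
  have hline : HasDerivAt (fun a : ℝ => x + a • distGrad S x) (distGrad S x) 0 := by
    simpa using ((hasDerivAt_id (0 : ℝ)).smul_const (distGrad S x)).const_add x
  have h := HasFDerivAt.comp_hasDerivAt (x := (0 : ℝ)) (l := distGrad S)
    (l' := fderiv ℝ (distGrad S) x) (f := fun a : ℝ => x + a • distGrad S x)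
    (by simpa using hS.hasFDerivAt_distGrad hx) hline
  refine h.unique ((hasDerivAt_const (0 : ℝ) (distGrad S x)).congr_of_eventuallyEq ?_)
  filter_upwards [Ioo_mem_nhds (show -infDist x S < 0 by linarith [hx.1])
    (show 0 < r - infDist x S by linarith [hx.2])] with a ha
  have := hN.distGrad_eq hS (s := infDist x S + a) ⟨by linarith [ha.1], by linarith [ha.2]⟩
  rwa [add_smul, ← add_assoc, foot_add] at this

/-- If the foot map has maximal rank at `x`, then the only possible unit normals at the foot of `x`
are the two directions of the line through `x`. -/
lemma unitNormal_eq_or_eq_neg (hx : x ∈ tube S r)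
    (hreg : ∀ u, shiftDeriv S (infDist x S) x u = 0 → u = 0)
    (hw : IsUnitNormal S r (foot S x) w) : w = distGrad S x ∨ w = -distGrad S x := by
  set v := distGrad S x with hv
  have hvn : ‖v‖ = 1 := hS.norm_distGrad hx
  have hr := hS.pos
  have hmin : IsLocalMin (fun y => ‖foot S y - (foot S x + (r / 2) • w)‖ ^ 2) x := by
    filter_upwards [isOpen_tube.mem_nhds hx] with y hy
    have h1 := hw.infDist_eq (r / 2) ⟨by linarith, by linarith⟩
    have h2 := infDist_le_dist_of_mem (x := foot S x + (r / 2) • w) (hS.foot_mem hy)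
    rw [sub_add_cancel_left, norm_neg, norm_smul, hw.norm_eq, mul_one,
      Real.norm_of_nonneg (by linarith)]
    rw [h1, dist_comm, dist_eq_norm] at h2
    gcongr
  have hder := hmin.hasFDerivAt_eq_zero (((hS.hasFDerivAt_foot hx).sub_const _).norm_sq)
  obtain ⟨e, he⟩ := exists_equiv_of_injective rfl _ hreg
  have key : ∀ u, ⟪w, shiftDeriv S (infDist x S) x u - ⟪v, u⟫_ℝ • v⟫_ℝ = 0 := by
    intro u
    have := congrArg (fun A => A u) hder
    simp only [sub_add_cancel_left, ContinuousLinearMap.comp_apply,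
      smul_apply, zero_apply,
      innerSL_apply_apply, inner_neg_left, real_inner_smul_left] at this
    have h3 : (r / 2) * ⟪w, shiftDeriv S (infDist x S) x u - ⟪v, u⟫_ℝ • v⟫_ℝ = 0 := by
      simpa using this
    exact (mul_eq_zero.mp h3).resolve_left (by linarith)
  have hwv : w = ⟪w, v⟫_ℝ • v := by
    refine ext_inner_right ℝ fun z => ?_
    have hz : shiftDeriv S (infDist x S) x (e.symm z) = z := by
      rw [← he]; exact e.apply_symm_apply z
    have hvz : ⟪v, e.symm z⟫_ℝ = ⟪v, z⟫_ℝ := by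
      conv_rhs => rw [← hz, shiftDeriv_apply, inner_sub_right, inner_smul_right,
        hS.inner_distGrad_fderiv hx, mul_zero, sub_zero]
    have := key (e.symm z)
    rw [hz, hvz, inner_sub_right, inner_smul_right] at this
    rw [real_inner_smul_left]
    linarith
  have habs : |⟪w, v⟫_ℝ| = 1 := by
    have := congrArg norm hwv
    rw [norm_smul, hw.norm_eq, hvn, mul_one, Real.norm_eq_abs] at this
    exact this.symm
  rcases (abs_eq zero_le_one).mp habs with h | h
  · left; rw [hwv, h, one_smul]
  · right; rw [hwv, h, neg_one_smul]

omit [FiniteDimensional ℝ E] in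
lemma eventually_mem_tube (hp : p ∈ S) {z : ℕ → E} (hz : ∀ n, z n ∉ S)
    (hzp : Tendsto z atTop (𝓝 p)) : ∀ᶠ n in atTop, z n ∈ tube S r := by
  filter_upwards [(tendsto_infDist_zero hp hzp).eventually (gt_mem_nhds hS.pos)] with n hn
  exact ⟨(hS.isClosed.notMem_iff_infDist_pos hS.nonempty).mp (hz n), hn⟩

/-- Along a subsequence, the gradients of the distance at points outside `S` that converge to a
point of `S` converge to a unit normal. -/
lemma exists_subseq_isUnitNormal (hp : p ∈ S) {z : ℕ → E} (hz : ∀ n, z n ∉ S)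
    (hzp : Tendsto z atTop (𝓝 p)) : ∃ w, ∃ ψ : ℕ → ℕ, StrictMono ψ ∧
      Tendsto (fun n => distGrad S (z (ψ n))) atTop (𝓝 w) ∧ IsUnitNormal S r p w := by
  obtain ⟨w, -, ψ, hψ, hw⟩ := (isCompact_closedBall (0 : E) 1).tendsto_subseq
    (x := fun n => distGrad S (z n)) fun n => by simpa using norm_distGrad_le
  refine ⟨w, ψ, hψ, hw, .of_tendsto hS.isClosed ?_ hw
    ((hψ.tendsto_atTop.eventually (hS.eventually_mem_tube hp hz hzp)).mono
      fun n hn => hS.isUnitNormal_foot hn)⟩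
  simpa [foot] using (hzp.comp hψ.tendsto_atTop).sub
    (((tendsto_infDist_zero hp hzp).comp hψ.tendsto_atTop).smul hw)

/-- Where the foot map has maximal rank, a set with empty interior has normals on both sides. -/
lemma isUnitNormal_neg (hint : interior S = ∅) (hx : x ∈ tube S r)
    (hreg : ∀ u, shiftDeriv S (infDist x S) x u = 0 → u = 0) :
    IsUnitNormal S r (foot S x) (-distGrad S x) := by
  set t := infDist x S with ht
  set v := distGrad S x with hv
  set p := foot S x with hp
  have hpx : p + t • v = x := foot_add x
  obtain ⟨e, he⟩ := exists_equiv_of_injective rfl _ hreg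
  have hΦd : HasFDerivAt (normalShift S t) (e : E →L[ℝ] E) x := by
    rw [he]; exact hS.hasFDerivAt_normalShift hx
  have hΦc : ContDiffAt ℝ ∞ (normalShift S t) x := hS.contDiffAt_normalShift hx
  set φ := hΦc.toOpenPartialHomeomorph _ hΦd (by simp) with hφ
  have hφe : ∀ y, φ y = normalShift S t y := fun y => rfl
  have hxs : x ∈ φ.source := hΦc.mem_toOpenPartialHomeomorph_source hΦd (by simp)
  have hφx : φ x = p := by rw [hφe, normalShift_eq, sub_self, zero_smul, add_zero]
  have hline : Tendsto (fun a : ℝ => x - a • v) (𝓝[>] 0) (𝓝 x) := by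
    have : ContinuousAt (fun a : ℝ => x - a • v) 0 := by fun_prop
    simpa [ContinuousAt] using this.mono_left nhdsWithin_le_nhds
  set L : Set E := φ.target ∩ φ.symm ⁻¹' {y | infDist y S < t} with hL
  have hLo : IsOpen L := φ.isOpen_inter_preimage_symm
    (isOpen_lt (continuous_infDist_pt S) continuous_const)
  have hpL : p ∈ closure L := by
    refine mem_closure_of_tendsto (f := fun a : ℝ => φ (x - a • v)) (b := 𝓝[>] 0) ?_ ?_
    · rw [← hφx]
      exact (φ.continuousAt hxs).tendsto.comp hline
    · filter_upwards [hline.eventually (φ.open_source.mem_nhds hxs),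
        Ioo_mem_nhdsGT hx.1] with a ha ha2
      refine ⟨φ.map_source ha, ?_⟩
      rw [mem_preimage, φ.left_inv ha, mem_ofPred_eq,
        show x - a • v = foot S x + (t - a) • v by rw [← hp, ← hpx]; module,
        hS.infDist_foot_add_of_le hx (by linarith [ha2.2]) (by linarith [ha2.1])]
      linarith [ha2.1]
  have hdense : Dense Sᶜ := by rwa [← interior_eq_empty_iff_dense_compl]
  have hpLS : p ∈ closure (L ∩ Sᶜ) :=
    closure_minimal (hdense.open_subset_closure_inter hLo) isClosed_closure hpL
  obtain ⟨z, hz, hzp⟩ := mem_closure_iff_seq_limit.mp hpLS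
  obtain ⟨w, ψ, hψ, hw, hwN⟩ :=
    hS.exists_subseq_isUnitNormal (hS.foot_mem hx) (fun n => (hz n).2) hzp
  have hzψ := hzp.comp hψ.tendsto_atTop
  have hdψ := (tendsto_infDist_zero (hS.foot_mem hx) hzp).comp hψ.tendsto_atTop
  have htψ := hψ.tendsto_atTop.eventually
    (hS.eventually_mem_tube (hS.foot_mem hx) (fun n => (hz n).2) hzp)
  rcases hS.unitNormal_eq_or_eq_neg hx hreg hwN with h | h
  swap
  · rwa [h] at hwN
  exfalso
  have hy : Tendsto (fun n => z (ψ n) + t • distGrad S (z (ψ n))) atTop (𝓝 x) := by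
    rw [h] at hw
    rw [← hpx]
    exact hzψ.add (hw.const_smul t)
  obtain ⟨n, hn1, hn2, hn3⟩ := ((hy.eventually (φ.open_source.mem_nhds hxs)).and
    ((hdψ.eventually (gt_mem_nhds (sub_pos.mpr hx.2))).and htψ)).exists
  set a := z (ψ n) with ha
  have hN := hS.isUnitNormal_foot hn3
  have hb : infDist a S + t ∈ Ioo 0 r :=
    ⟨by linarith [hn3.1, hx.1], by simp only [Function.comp_apply, ← ha] at hn2; linarith⟩
  have hbe : foot S a + (infDist a S + t) • distGrad S a = a + t • distGrad S a := by
    rw [add_smul, ← add_assoc, foot_add]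
  have h1 := hN.infDist_eq _ hb
  have h2 := hN.distGrad_eq hS hb
  rw [hbe] at h1 h2
  have h3 : φ (a + t • distGrad S a) = a := by
    rw [hφe, normalShift, h2, add_sub_cancel_right]
  have h4 : infDist (φ.symm a) S < t := (hz (ψ n)).1.2
  rw [← h3, φ.left_inv hn1, h1] at h4
  linarith [hn3.1]

end SmoothTube

end SmoothTube

/-- The rotation of the plane by a right angle. -/
def rot (v : E2) : E2 := pt (-(v 1)) (v 0)

lemma pt_apply_zero (a b : ℝ) : pt a b 0 = a := rfl

lemma pt_apply_one (a b : ℝ) : pt a b 1 = b := rfl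

lemma inner_eq (u v : E2) : ⟪u, v⟫_ℝ = u 0 * v 0 + u 1 * v 1 := by
  simp [PiLp.inner_apply, Fin.sum_univ_two, mul_comm]

lemma continuous_rot : Continuous rot := by
  unfold rot pt
  refine (EuclideanSpace.equiv (Fin 2) ℝ).symm.continuous.comp (continuous_pi fun i => ?_)
  fin_cases i <;> simp <;> fun_prop

lemma inner_rot_self (v : E2) : ⟪rot v, v⟫_ℝ = 0 := by
  rw [inner_eq, rot, pt_apply_zero, pt_apply_one]; ring

lemma inner_rot_rot (v : E2) : ⟪rot v, rot v⟫_ℝ = ‖v‖ ^ 2 := by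
  rw [← real_inner_self_eq_norm_sq v, inner_eq, inner_eq]
  simp only [rot, pt_apply_zero, pt_apply_one]
  ring

lemma norm_rot (v : E2) : ‖rot v‖ = ‖v‖ := by
  rw [← sq_eq_sq₀ (norm_nonneg _) (norm_nonneg _), ← inner_rot_rot v, real_inner_self_eq_norm_sq]

lemma eq_inner_smul_add {v : E2} (hv : ‖v‖ = 1) (u : E2) :
    u = ⟪v, u⟫_ℝ • v + ⟪rot v, u⟫_ℝ • rot v := by
  have h : v 0 * v 0 + v 1 * v 1 = 1 := by
    rw [← inner_eq, real_inner_self_eq_norm_sq, hv, one_pow]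
  ext i
  fin_cases i
  · simp only [inner_eq, rot, pt_apply_zero, pt_apply_one, PiLp.add_apply, PiLp.smul_apply,
      smul_eq_mul, Fin.zero_eta]
    linear_combination -(u 0) * h
  · simp only [inner_eq, rot, pt_apply_zero, pt_apply_one, PiLp.add_apply, PiLp.smul_apply,
      smul_eq_mul, Fin.mk_one]
    linear_combination -(u 1) * h

/-- The curvature at `x` of the level set of the distance function of `S` through `x`. -/
def levelCurv (S : Set E2) (x : E2) : ℝ :=
  ⟪rot (distGrad S x), fderiv ℝ (distGrad S) x (rot (distGrad S x))⟫_ℝ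

/-- The part of the tube on which the foot map degenerates. -/
def focalSet (S : Set E2) (r : ℝ) : Set E2 :=
  {x | x ∈ tube S r ∧ infDist x S * levelCurv S x = 1}

namespace SmoothTube

variable {S : Set E2} {r s s' : ℝ} {x p : E2} (hS : SmoothTube S r)
include hS

lemma fderiv_distGrad_apply (hx : x ∈ tube S r) (u : E2) :
    fderiv ℝ (distGrad S) x u =
      (⟪rot (distGrad S x), u⟫_ℝ * levelCurv S x) • rot (distGrad S x) := by
  have hv := hS.norm_distGrad hx
  have h1 : fderiv ℝ (distGrad S) x (rot (distGrad S x)) =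
      levelCurv S x • rot (distGrad S x) := by
    conv_lhs => rw [eq_inner_smul_add hv (fderiv ℝ (distGrad S) x (rot (distGrad S x))),
      hS.inner_distGrad_fderiv hx, zero_smul, zero_add]
    rfl
  conv_lhs => rw [eq_inner_smul_add hv u, map_add, map_smul, map_smul,
    hS.fderiv_distGrad_self hx, smul_zero, zero_add, h1, smul_smul]

lemma shiftDeriv_rot (hx : x ∈ tube S r) :
    shiftDeriv S s x (rot (distGrad S x)) = (1 - s * levelCurv S x) • rot (distGrad S x) := by
  rw [shiftDeriv_apply, hS.fderiv_distGrad_apply hx, inner_rot_rot, hS.norm_distGrad hx]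
  module

lemma shiftDeriv_injective (hx : x ∈ tube S r) (h : s * levelCurv S x ≠ 1) (u : E2)
    (hu : shiftDeriv S s x u = 0) : u = 0 := by
  have hv := hS.norm_distGrad hx
  have h1 : ⟪distGrad S x, u⟫_ℝ = 0 := by
    have := congrArg (fun z => ⟪distGrad S x, z⟫_ℝ) hu
    simpa [shiftDeriv_apply, inner_sub_right, inner_smul_right, hS.inner_distGrad_fderiv hx]
      using this
  have h2 : ⟪rot (distGrad S x), u⟫_ℝ = 0 := by
    have := congrArg (fun z => ⟪rot (distGrad S x), z⟫_ℝ) hu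
    simp only [shiftDeriv_apply, inner_sub_right, inner_smul_right, hS.fderiv_distGrad_apply hx,
      inner_rot_rot, hv, inner_zero_right] at this
    have h3 : ⟪rot (distGrad S x), u⟫_ℝ * (1 - s * levelCurv S x) = 0 := by
      linear_combination this
    exact (mul_eq_zero.mp h3).resolve_right (sub_ne_zero.mpr h.symm)
  rw [eq_inner_smul_add hv u, h1, h2, zero_smul, zero_smul, add_zero]

lemma mul_levelCurv_ne_one (hx : x ∈ tube S r) (hz : normalShift S s x ∈ tube S r)
    (h : ∀ᶠ y in 𝓝 x, normalShift S s' (normalShift S s y) = y) : s * levelCurv S x ≠ 1 := by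
  intro h1
  have hc := (hS.hasFDerivAt_normalShift (s := s') hz).comp x
    (hS.hasFDerivAt_normalShift (s := s) hx)
  have h2 := congrArg (fun A => A (rot (distGrad S x)))
    (hc.unique ((hasFDerivAt_id x).congr_of_eventuallyEq h))
  simp only [ContinuousLinearMap.comp_apply, hS.shiftDeriv_rot hx, h1, sub_self, zero_smul,
    map_zero, ContinuousLinearMap.id_apply] at h2
  have h3 := congrArg norm h2
  rw [norm_zero, norm_rot, hS.norm_distGrad hx] at h3
  exact zero_ne_one h3

lemma continuousAt_levelCurv (hx : x ∈ tube S r) : ContinuousAt (levelCurv S) x := by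
  have h := continuous_rot.continuousAt.comp (hS.continuousAt_distGrad hx)
  exact h.inner ((hS.continuousAt_fderiv_distGrad hx).clm_apply h)

lemma continuousAt_mul_levelCurv (hx : x ∈ tube S r) :
    ContinuousAt (fun y => infDist y S * levelCurv S y) x :=
  (continuous_infDist_pt S).continuousAt.mul (hS.continuousAt_levelCurv hx)

lemma levelCurv_mul_le (hint : interior S = ∅) (hx : x ∈ tube S r) (hne : x ∉ focalSet S r) :
    (infDist x S + r) * levelCurv S x ≤ 1 := by
  have hne : infDist x S * levelCurv S x ≠ 1 := fun h => hne ⟨hx, h⟩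
  have hd := (continuous_infDist_pt S).continuousAt (x := x)
  have hmain : ∀ s ∈ Ioo 0 (infDist x S + r), s * levelCurv S x ≠ 1 := by
    intro s hs
    rcases lt_trichotomy s (infDist x S) with h | h | h
    · have key : ∀ y ∈ tube S r, s < infDist y S →
          normalShift S s y ∈ tube S r ∧ distGrad S (normalShift S s y) = distGrad S y := by
        intro y hy hsy
        have hN := hS.isUnitNormal_foot hy
        have hI : infDist y S - s ∈ Ioo 0 r := ⟨by linarith, by linarith [hs.1, hy.2]⟩
        rw [normalShift_eq]
        exact ⟨hN.mem_tube hI, hN.distGrad_eq hS hI⟩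
      refine hS.mul_levelCurv_ne_one (s' := -s) hx (key x hx h).1 ?_
      filter_upwards [isOpen_tube.mem_nhds hx, hd.eventually (lt_mem_nhds h)] with y hy hsy
      rw [normalShift, (key y hy hsy).2, normalShift]
      module
    · rwa [h]
    · have key : ∀ y ∈ tube S r, infDist y S * levelCurv S y ≠ 1 → infDist y S < s →
          s < infDist y S + r →
          normalShift S s y ∈ tube S r ∧ distGrad S (normalShift S s y) = -distGrad S y := by
        intro y hy hcy hsy hsy2
        have hN := hS.isUnitNormal_neg hint hy (hS.shiftDeriv_injective hy hcy)
        have hI : s - infDist y S ∈ Ioo 0 r := ⟨by linarith, by linarith⟩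
        rw [normalShift_eq, show foot S y + (infDist y S - s) • distGrad S y =
          foot S y + (s - infDist y S) • -distGrad S y by module]
        exact ⟨hN.mem_tube hI, hN.distGrad_eq hS hI⟩
      refine hS.mul_levelCurv_ne_one (s' := s) hx (key x hx hne h hs.2).1 ?_
      filter_upwards [isOpen_tube.mem_nhds hx, hd.eventually (gt_mem_nhds h),
        (hS.continuousAt_mul_levelCurv hx).eventually (isOpen_ne.mem_nhds hne),
        (hd.add_const r).eventually (lt_mem_nhds hs.2)] with y hy hsy hcy hsy2
      rw [normalShift, (key y hy hcy hsy hsy2).2, normalShift]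
      module
  by_contra! hlt
  have hdr : 0 < infDist x S + r := add_pos hx.1 hS.pos
  have hκ : 0 < levelCurv S x := by
    by_contra! hκ
    nlinarith
  refine hmain (levelCurv S x)⁻¹ ⟨by positivity, ?_⟩ (inv_mul_cancel₀ hκ.ne')
  rwa [inv_lt_iff_one_lt_mul₀ hκ]

lemma isOpen_focalSet (hint : interior S = ∅) : IsOpen (focalSet S r) := by
  refine isOpen_iff_mem_nhds.mpr fun x hx => ?_
  have hc : ContinuousAt (fun y => (infDist y S + r) * levelCurv S y) x :=
    ((continuous_infDist_pt S).continuousAt.add_const r).mul (hS.continuousAt_levelCurv hx.1)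
  have hκ : 0 < levelCurv S x := by
    by_contra! hκ
    nlinarith [hx.1.1, hx.2]
  have h1 : 1 < (infDist x S + r) * levelCurv S x := by
    nlinarith [hx.2, mul_pos hS.pos hκ]
  filter_upwards [isOpen_tube.mem_nhds hx.1, hc.eventually (lt_mem_nhds h1)] with y hy hy2
  by_contra hne
  exact hy2.not_ge (hS.levelCurv_mul_le hint hy hne)

lemma fderiv_foot_eq_zero (hx : x ∈ focalSet S r) : fderiv ℝ (foot S) x = 0 := by
  rw [(hS.hasFDerivAt_foot hx.1).fderiv]
  ext1 u
  have hu := eq_inner_smul_add (hS.norm_distGrad hx.1) u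
  rw [sub_apply, shiftDeriv_apply, hS.fderiv_distGrad_apply hx.1, smul_smul,
    mul_left_comm, hx.2, mul_one, ContinuousLinearMap.smulRight_apply, innerSL_apply_apply,
    zero_apply, sub_sub, add_comm (_ • rot _), sub_eq_zero]
  exact hu

lemma eq_singleton (hint : interior S = ∅) (hconn : IsConnected S) (hx : x ∈ focalSet S r) :
    S = {foot S x} := by
  set p := foot S x with hp
  set t := infDist x S with ht
  have htpos : 0 < t := hx.1.1
  have hpS : p ∈ S := hS.foot_mem hx.1
  set M : Set E2 := {y | y ∈ focalSet S r ∧ foot S y = p} with hM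
  have hMo : IsOpen M := by
    refine isOpen_iff_mem_nhds.mpr fun y hy => ?_
    obtain ⟨ε, hε, hball⟩ := Metric.isOpen_iff.mp (hS.isOpen_focalSet hint) y hy.1
    filter_upwards [ball_mem_nhds y hε] with z hz
    refine ⟨hball hz, ?_⟩
    rw [← hy.2]
    exact isOpen_ball.is_const_of_fderiv_eq_zero (𝕜 := ℝ) (convex_ball y ε).isPreconnected
      (fun a ha => (hS.hasFDerivAt_foot (hball ha).1).differentiableAt.differentiableWithinAt)
      (fun a ha => hS.fderiv_foot_eq_zero (hball ha)) hz (mem_ball_self hε)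
  have hMd : ∀ y ∈ M, dist y p = infDist y S := by
    intro y hy
    rw [← hy.2, dist_eq_norm, foot, sub_sub_cancel, norm_smul, hS.norm_distGrad hy.1.1, mul_one,
      Real.norm_of_nonneg hy.1.1.1.le]
  have hxM : x ∈ M := ⟨hx, rfl⟩
  have hsub : sphere p t ⊆ M := by
    have hrank : 1 < Module.rank ℝ E2 := by
      rw [rank_eq_card_basis (EuclideanSpace.basisFun (Fin 2) ℝ).toBasis]
      simp
    refine (isPreconnected_sphere hrank p t).subset_of_closure_inter_subset hMo
      ⟨x, hMd x hxM, hxM⟩ ?_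
    rintro y ⟨hy, hys⟩
    obtain ⟨z, hz, hzy⟩ := mem_closure_iff_seq_limit.mp hy
    have hyd : infDist y S = t := by
      refine tendsto_nhds_unique (((continuous_infDist_pt S).tendsto y).comp hzy) ?_
      rw [← mem_sphere.mp hys]
      exact (hzy.dist tendsto_const_nhds).congr fun n => hMd _ (hz n)
    have hyT : y ∈ tube S r := by simpa [tube, hyd] using ⟨htpos, hx.1.2⟩
    refine ⟨⟨hyT, ?_⟩, ?_⟩
    · exact tendsto_nhds_unique ((hS.continuousAt_mul_levelCurv hyT).tendsto.comp hzy)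
        (tendsto_const_nhds.congr fun n => (hz n).1.2.symm)
    · exact tendsto_nhds_unique ((hS.continuousAt_foot hyT).tendsto.comp hzy)
        (tendsto_const_nhds.congr fun n => (hz n).2.symm)
  have hball : ∀ q ∈ S, q ∈ ball p t → q = p := by
    intro q hq hqp
    by_contra hne
    have hn : 0 < ‖q - p‖ := norm_pos_iff.mpr (sub_ne_zero.mpr hne)
    have hys : p + (t / ‖q - p‖) • (q - p) ∈ sphere p t := by
      rw [mem_sphere, dist_eq_norm, add_sub_cancel_left, norm_smul, norm_div, norm_norm,
        Real.norm_of_nonneg htpos.le, div_mul_cancel₀ _ hn.ne']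
    have h1 := hMd _ (hsub hys)
    rw [mem_sphere.mp hys] at h1
    have h2 := infDist_le_dist_of_mem (x := p + (t / ‖q - p‖) • (q - p)) hq
    rw [mem_ball, dist_eq_norm] at hqp
    have h3 : 0 ≤ t / ‖q - p‖ - 1 := by
      rw [sub_nonneg, le_div_iff₀ hn]; linarith
    rw [dist_eq_norm, show p + (t / ‖q - p‖) • (q - p) - q = (t / ‖q - p‖ - 1) • (q - p) by module,
      norm_smul, Real.norm_of_nonneg h3, sub_mul, div_mul_cancel₀ _ hn.ne', ← h1] at h2
    linarith
  refine Subset.antisymm ?_ (singleton_subset_iff.mpr hpS)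
  have hSb : S ⊆ ball p t := by
    refine hconn.isPreconnected.subset_of_closure_inter_subset isOpen_ball
      ⟨p, hpS, mem_ball_self htpos⟩ ?_
    rintro q ⟨hq, hqS⟩
    by_contra hqb
    have hqs : q ∈ sphere p t :=
      le_antisymm (closure_ball_subset_closedBall hq) (not_lt.mp hqb)
    exact (hsub hqs).1.1.1.ne' (infDist_zero_of_mem hqS)
  exact fun q hq => hball q hq (hSb hq)

lemma exists_isUnitNormal (hint : interior S = ∅) (hp : p ∈ S) : ∃ w, IsUnitNormal S r p w := by
  have hdense : Dense Sᶜ := by rwa [← interior_eq_empty_iff_dense_compl]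
  obtain ⟨z, hz, hzp⟩ := mem_closure_iff_seq_limit.mp (hdense p)
  obtain ⟨w, -, -, -, hw⟩ := hS.exists_subseq_isUnitNormal hp hz hzp
  exact ⟨w, hw⟩

end SmoothTube

lemma exists_contDiff_eq_of_contDiffAt {f : ℝ → ℝ} {ε : ℝ} (hε : 0 < ε)
    (hf : ∀ a, |a| < ε → ContDiffAt ℝ ∞ f a) :
    ∃ g : ℝ → ℝ, ContDiff ℝ ∞ g ∧ ∀ a, |a| < ε / 2 → g a = f a := by
  let χ : ContDiffBump (0 : ℝ) := ⟨ε / 2, 3 * ε / 4, by linarith, by linarith⟩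
  refine ⟨fun a => χ a * f a, contDiff_iff_contDiffAt.mpr fun a => ?_, fun a ha => ?_⟩
  · rcases lt_or_ge |a| ε with ha | ha
    · exact χ.contDiffAt.mul (hf a ha)
    · refine (contDiffAt_const (c := (0 : ℝ))).congr_of_eventuallyEq ?_
      filter_upwards [continuous_abs.continuousAt.eventually
        (lt_mem_nhds (show 3 * ε / 4 < |a| by linarith))] with b hb
      rw [χ.zero_of_le_dist (by simpa [χ] using hb.le), zero_mul]
  · beta_reduce
    rw [χ.one_of_mem_closedBall (by simpa [χ] using ha.le), one_mul]

/-- A rigid motion taking `p` to the origin and the unit vector `w` to the vertical direction. -/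
lemma exists_rigidMotion (p : E2) {w : E2} (hw : ‖w‖ = 1) :
    ∃ e : E2 ≃ᵃⁱ[ℝ] E2, ∀ z, e z = pt ⟪rot w, z - p⟫_ℝ ⟪w, z - p⟫_ℝ := by
  have hon : Orthonormal ℝ ![rot w, w] := by
    rw [orthonormal_iff_ite]
    intro i j
    fin_cases i <;> fin_cases j <;>
      simp [inner_rot_self, real_inner_comm (rot w) w, norm_rot, hw]
  have hspan : ⊤ ≤ Submodule.span ℝ (Set.range ![rot w, w]) := by
    intro u _
    rw [eq_inner_smul_add hw u]
    exact add_mem (Submodule.smul_mem _ _ (Submodule.subset_span ⟨1, rfl⟩))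
      (Submodule.smul_mem _ _ (Submodule.subset_span ⟨0, rfl⟩))
  refine ⟨(AffineIsometryEquiv.vaddConst ℝ p).symm.trans
    (OrthonormalBasis.mk hon hspan).repr.toAffineIsometryEquiv, fun z => ?_⟩
  ext i
  change (OrthonormalBasis.mk hon hspan).repr (z - p) i = _
  rw [OrthonormalBasis.repr_apply_apply]
  fin_cases i <;> simp [pt_apply_zero, pt_apply_one]

namespace SmoothTube

variable {S : Set E2} {r s : ℝ} {x p : E2} (hS : SmoothTube S r)
include hS

lemma normalShift_mem_iff (hint : interior S = ∅) (hx : x ∈ tube S r) (hne : x ∉ focalSet S r)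
    (hs : |infDist x S - s| < r) : normalShift S s x ∈ S ↔ infDist x S = s := by
  rw [normalShift_eq]
  refine ⟨fun h => ?_, fun h => by simpa [h] using hS.foot_mem hx⟩
  rw [abs_lt] at hs
  have h0 := infDist_zero_of_mem h
  rcases lt_trichotomy (infDist x S) s with hlt | heq | hlt
  · have hN := hS.isUnitNormal_neg hint hx (hS.shiftDeriv_injective hx fun h => hne ⟨hx, h⟩)
    have := hN.infDist_eq (s - infDist x S) ⟨by linarith, by linarith⟩
    rw [show foot S x + (s - infDist x S) • -distGrad S x =
      foot S x + (infDist x S - s) • distGrad S x by module, h0] at this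
    linarith
  · exact heq
  · have := (hS.isUnitNormal_foot hx).infDist_eq (infDist x S - s) ⟨by linarith, by linarith⟩
    linarith

lemma isCinfGraphAt (hint : interior S = ∅) (hfoc : focalSet S r = ∅) (hp : p ∈ S) :
    IsCinfGraphAt S p := by
  obtain ⟨w, hw⟩ := hS.exists_isUnitNormal hint hp
  have hr := hS.pos
  set t := r / 2 with ht
  have htI : t ∈ Ioo 0 r := ⟨by linarith, by linarith⟩
  set x := p + t • w with hx
  have hxT : x ∈ tube S r := hw.mem_tube htI
  have hxd : infDist x S = t := hw.infDist_eq t htI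
  have hxV : distGrad S x = w := hw.distGrad_eq hS htI
  have hreg : ∀ {y}, y ∉ focalSet S r := fun {y} h => by simp [hfoc] at h
  have hinj := hS.shiftDeriv_injective hxT (s := t) fun h => hreg ⟨hxT, hxd ▸ h⟩
  obtain ⟨e₁, he₁⟩ := exists_equiv_of_injective rfl _ hinj
  have hΦc : ContDiffAt ℝ ∞ (normalShift S t) x := hS.contDiffAt_normalShift hxT
  have hΦd : HasFDerivAt (normalShift S t) (e₁ : E2 →L[ℝ] E2) x := by
    rw [he₁]; exact hS.hasFDerivAt_normalShift hxT
  set φ := hΦc.toOpenPartialHomeomorph _ hΦd (by simp) with hφ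
  have hφe : ∀ y, φ y = normalShift S t y := fun y => rfl
  have hxφ : x ∈ φ.source := hΦc.mem_toOpenPartialHomeomorph_source hΦd (by simp)
  have hφx : φ x = p := by rw [hφe, normalShift, hxV, hx, add_sub_cancel_right]
  set K : E2 → ℝ × ℝ := fun y => (⟪rot w, normalShift S t y - p⟫_ℝ, infDist y S - t) with hK
  have hKc : ∀ y ∈ tube S r, ContDiffAt ℝ ∞ K y := fun y hy =>
    (contDiffAt_const.inner ℝ ((hS.contDiffAt_normalShift hy).sub contDiffAt_const)).prodMk
      ((hS.contDiffAt hy).sub contDiffAt_const)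
  have hKfd : HasFDerivAt K (((innerSL ℝ (rot w)).comp (shiftDeriv S t x)).prod
      (innerSL ℝ w)) x := by
    refine HasFDerivAt.prodMk ?_ ?_
    · exact (innerSL ℝ (rot w)).hasFDerivAt.comp x
        ((hS.hasFDerivAt_normalShift hxT).sub_const p)
    · rw [← hxV]
      exact (hS.hasFDerivAt_infDist hxT).sub_const t
  obtain ⟨e₂, he₂⟩ := exists_equiv_of_injective (F := ℝ × ℝ) (by simp) _
    (fun u (hu : (((innerSL ℝ (rot w)).comp (shiftDeriv S t x)).prod (innerSL ℝ w)) u = 0) => by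
      obtain ⟨h1, h2⟩ := Prod.ext_iff.mp hu
      simp only [ContinuousLinearMap.prod_apply, ContinuousLinearMap.comp_apply,
        innerSL_apply_apply, Prod.fst_zero, Prod.snd_zero] at h1 h2
      refine hinj u ?_
      rw [eq_inner_smul_add hw.norm_eq (shiftDeriv S t x u), h1, zero_smul, add_zero,
        shiftDeriv_apply, inner_sub_right, inner_smul_right, ← hxV,
        hS.inner_distGrad_fderiv hxT, hxV, h2]
      simp)
  rw [← he₂] at hKfd
  set k := (hKc x hxT).toOpenPartialHomeomorph _ hKfd (by simp) with hk
  have hke : ∀ y, k y = K y := fun y => rfl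
  have hxk : x ∈ k.source := (hKc x hxT).mem_toOpenPartialHomeomorph_source hKfd (by simp)
  have hkx : k x = 0 := by
    rw [hke]
    simp only [hK, hxd, ← hφe, hφx, sub_self, inner_zero_right]
    rfl
  have hequiv : ∀ᶠ y in 𝓝 x, fderiv ℝ K y ∈
      range (ContinuousLinearEquiv.toContinuousLinearMap : (E2 ≃L[ℝ] ℝ × ℝ) → _) := by
    have hc : ContinuousAt (fderiv ℝ K) x :=
      ((hKc x hxT).fderiv_right (m := ∞) (by simp)).continuousAt
    refine hc.eventually_mem ?_
    rw [hKfd.fderiv]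
    exact e₂.nhds
  obtain ⟨O, hO, hOo, hxO⟩ := _root_.mem_nhds_iff.mp (inter_mem (inter_mem
    (k.open_source.mem_nhds hxk) (φ.open_source.mem_nhds hxφ))
      (inter_mem (isOpen_tube.mem_nhds hxT) hequiv))
  have hOk : O ⊆ k.source := fun y hy => (hO hy).1.1
  have hOφ : O ⊆ φ.source := fun y hy => (hO hy).1.2
  have hOT : O ⊆ tube S r := fun y hy => (hO hy).2.1
  obtain ⟨ε, hε, hball⟩ := Metric.isOpen_iff.mp (k.isOpen_image_of_subset_source hOo hOk) 0
    ⟨x, hxO, hkx⟩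
  have hball' : ∀ q ∈ ball (0 : ℝ × ℝ) ε, k.symm q ∈ O ∧ K (k.symm q) = q := by
    intro q hq
    obtain ⟨y, hy, rfl⟩ := hball hq
    rw [k.left_inv (hOk hy)]
    exact ⟨hy, rfl⟩
  have hmem : ∀ {a δ : ℝ}, (a, (0 : ℝ)) ∈ ball (0 : ℝ × ℝ) δ ↔ |a| < δ := by
    intro a δ
    simp [Prod.norm_def]
  have hiff : ∀ y ∈ O, φ y ∈ S ↔ infDist y S = t := fun y hy =>
    hS.normalShift_mem_iff hint (hOT hy) hreg
      (abs_lt.mpr ⟨by linarith [(hOT hy).1], by linarith [(hOT hy).2]⟩)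
  obtain ⟨g, hg, hgeq⟩ := exists_contDiff_eq_of_contDiffAt hε
    (f := fun a => ⟪w, φ (k.symm (a, 0)) - p⟫_ℝ) (fun a ha => by
      obtain ⟨hyO, -⟩ := hball' (a, 0) (hmem.mpr ha)
      obtain ⟨e₃, he₃⟩ := (hO hyO).2.2
      have hat : (a, (0 : ℝ)) ∈ k.target := by
        obtain ⟨y, hy, hya⟩ := hball (hmem.mpr ha)
        exact hya ▸ k.map_source (hOk hy)
      have hsymm : ContDiffAt ℝ ∞ k.symm (a, 0) := by
        refine k.contDiffAt_symm (f₀' := e₃) hat ?_ (hKc _ (hOT hyO))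
        rw [he₃]
        exact ((hKc _ (hOT hyO)).differentiableAt (by simp)).hasFDerivAt
      have hγ : ContDiffAt ℝ ∞ (fun a : ℝ => k.symm (a, 0)) a :=
        ContDiffAt.comp (g := k.symm) a hsymm (contDiffAt_id.prodMk contDiffAt_const)
      exact contDiffAt_const.inner ℝ
        ((ContDiffAt.comp (g := normalShift S t) a (hS.contDiffAt_normalShift (hOT hyO)) hγ).sub
          contDiffAt_const))
  obtain ⟨e, he⟩ := exists_rigidMotion p hw.norm_eq
  have hVo : IsOpen (O ∩ (k.source ∩ k ⁻¹' ball 0 (ε / 2))) :=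
    hOo.inter (k.isOpen_inter_preimage isOpen_ball)
  refine ⟨e, φ '' (O ∩ (k.source ∩ k ⁻¹' ball 0 (ε / 2))), g, -(ε / 2), ε / 2,
    φ.isOpen_image_of_subset_source hVo fun y hy => hOφ hy.1,
    ⟨x, ⟨hxO, hxk, by simpa [hkx] using hε⟩, hφx⟩, by linarith, hg, ?_⟩
  ext q
  constructor
  · rintro ⟨_, ⟨hyS, y, ⟨hyO, hyk, hyb⟩, rfl⟩, rfl⟩
    have hky : k y = (⟪rot w, φ y - p⟫_ℝ, 0) :=
      Prod.ext rfl (sub_eq_zero.mpr ((hiff y hyO).mp hyS))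
    rw [mem_preimage, hky, hmem] at hyb
    refine ⟨_, abs_lt.mp hyb, ?_⟩
    dsimp only
    rw [he, hgeq _ hyb, ← hky, k.left_inv hyk]
  · rintro ⟨a, ha, rfl⟩
    have ha' : |a| < ε / 2 := abs_lt.mpr ha
    obtain ⟨hyO, hKy⟩ := hball' (a, 0) (hmem.mpr (by linarith))
    refine ⟨φ (k.symm (a, 0)), ⟨(hiff _ hyO).mpr (sub_eq_zero.mp (congrArg Prod.snd hKy)),
      _, ⟨hyO, hOk hyO, ?_⟩, rfl⟩, ?_⟩
    · rw [mem_preimage, hke, hKy]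
      exact hmem.mpr ha'
    · beta_reduce
      rw [he, hgeq a ha']
      exact congrArg (pt · _) (congrArg Prod.fst hKy)

end SmoothTube

/-- **Theorem.** If `S ⊆ ℝ²` is nonempty, closed, connected, has empty interior, and its
distance function is `C^∞` on `{0 < d_S < r_S}` for some `r_S > 0`, then `S` is either a
singleton or a `1`-dimensional manifold without boundary of class `C^∞`. -/
theorem stmt3 (S : Set E2) (rS : ℝ) (hrS : 0 < rS)
    (hne : S.Nonempty) (hcl : IsClosed S) (hconn : IsConnected S)
    (hint : interior S = ∅)
    (hprox : ContDiffOn ℝ (⊤ : ℕ∞) (fun x => infDist x S)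
      {x | 0 < infDist x S ∧ infDist x S < rS}) :
    (∃ p, S = {p}) ∨ (∀ p ∈ S, IsCinfGraphAt S p) := by
  have hS : SmoothTube S rS := ⟨hne, hcl, hrS, hprox⟩
  rcases (focalSet S rS).eq_empty_or_nonempty with h | ⟨x, hx⟩
  · exact Or.inr fun p hp => hS.isCinfGraphAt hint h hp
  · exact Or.inl ⟨foot S x, hS.eq_singleton hint hconn hx⟩
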